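/- Let x ∈ ℝ^k, let l : ℝ^k → ℝ be twice continuously differentiable with gradient g = ∇l(x) and symmetric Hessian H = ∇²l(x), and let ε ∼ N(0, σ²I_k). If the exact second-order expansion l(x+ε) = l(x) + gᵀε + ½ εᵀHε holds, then E[(l(x+ε) − l(x))²] = σ²‖g‖² + (σ⁴/4)(2‖H‖_F² + (tr H)²). In particular E[(l(x+ε) − l(x))²] ≥ (σ⁴/2)‖H‖_F² = (σ⁴/2) Σ_i λ_i², where λ_i are the eigenvalues of H. -/

import Mathlib

open scoped ENNReal NNReal
open Matrix MeasureTheory ProbabilityTheory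


lemma gm_integrable (v : ℝ≥0) (n : ℕ) : Integrable (fun x : ℝ => x ^ n) (gaussianReal 0 v) := by
  have := (memLp_id_gaussianReal (μ := 0) (v := v) (n : ℝ≥0)).integrable_norm_pow'
  simp only [id, ← norm_pow] at this
  exact (integrable_norm_iff (by fun_prop)).1 (by simpa using this)

lemma gm_eq (v : ℝ≥0) (n : ℕ) :
    ∫ x, x ^ n ∂(gaussianReal 0 v) = iteratedDeriv n (fun t : ℝ => Real.exp (v * t ^ 2 / 2)) 0 := by
  have h := iteratedDeriv_mgf_zero (X := id) (μ := gaussianReal 0 v) (by simp) n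
  rw [mgf_id_gaussianReal] at h
  simp only [zero_mul, zero_add] at h
  rw [h]; simp

lemma gm_d (v : ℝ) : ∀ q q' : ℝ → ℝ, (∀ t, HasDerivAt q (q' t) t) → 
    deriv (fun t : ℝ => q t * Real.exp (v * t ^ 2 / 2)) =
      fun t : ℝ => (q' t + v * t * q t) * Real.exp (v * t ^ 2 / 2) := by
  intro q q' h
  ext t
  have h1 : HasDerivAt (fun t : ℝ => v * t ^ 2 / 2) (v * t) t := by
    have := (((hasDerivAt_id t).pow 2).const_mul v).div_const 2
    simp only [id, Nat.cast_ofNat, mul_one] at this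
    refine this.congr_deriv ?_
    norm_num
    ring
  rw [((h t).fun_mul h1.exp).deriv]
  ring

lemma gm_all (v : ℝ≥0) :
    ∫ x, x ^ 1 ∂(gaussianReal 0 v) = 0 ∧ ∫ x, x ^ 2 ∂(gaussianReal 0 v) = v ∧
    ∫ x, x ^ 3 ∂(gaussianReal 0 v) = 0 ∧ ∫ x, x ^ 4 ∂(gaussianReal 0 v) = 3 * v ^ 2 := by
  simp only [gm_eq]
  set w : ℝ := (v : ℝ)
  have d1 : iteratedDeriv 1 (fun t : ℝ => Real.exp (w * t ^ 2 / 2)) =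
      fun t : ℝ => (w * t) * Real.exp (w * t ^ 2 / 2) := by
    rw [iteratedDeriv_one]
    have := gm_d w (fun _ => 1) (fun _ => 0) (fun t => hasDerivAt_const _ _)
    simpa using this
  have d2 : iteratedDeriv 2 (fun t : ℝ => Real.exp (w * t ^ 2 / 2)) =
      fun t : ℝ => (w + w ^ 2 * t ^ 2) * Real.exp (w * t ^ 2 / 2) := by
    rw [iteratedDeriv_succ, d1, gm_d w (fun t => w * t) (fun _ => w)]
    · ext t; ring
    · intro t; simpa using (hasDerivAt_id t).const_mul w
  have d3 : iteratedDeriv 3 (fun t : ℝ => Real.exp (w * t ^ 2 / 2)) =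
      fun t : ℝ => (3 * w ^ 2 * t + w ^ 3 * t ^ 3) * Real.exp (w * t ^ 2 / 2) := by
    rw [iteratedDeriv_succ, d2, gm_d w (fun t => w + w ^ 2 * t ^ 2) (fun t => w ^ 2 * (2 * t))]
    · ext t; ring
    · intro t; simpa using (((hasDerivAt_id t).pow 2).const_mul (w ^ 2)).const_add w
  have d4 : iteratedDeriv 4 (fun t : ℝ => Real.exp (w * t ^ 2 / 2)) =
      fun t : ℝ => (3 * w ^ 2 + 6 * w ^ 3 * t ^ 2 + w ^ 4 * t ^ 4) * Real.exp (w * t ^ 2 / 2) := by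
    rw [iteratedDeriv_succ, d3, gm_d w (fun t => 3 * w ^ 2 * t + w ^ 3 * t ^ 3)
      (fun t => 3 * w ^ 2 + w ^ 3 * (3 * t ^ 2))]
    · ext t; ring
    · intro t
      simpa using ((hasDerivAt_id t).const_mul (3 * w ^ 2)).fun_add
        (((hasDerivAt_id t).pow 3).const_mul (w ^ 3))
  rw [d1, d2, d3, d4]
  simp

section
variable {k : ℕ} (v : ℝ≥0)

lemma mono_integrable (n : Fin k → ℕ) :
    Integrable (fun e : Fin k → ℝ => ∏ m, e m ^ n m) (Measure.pi fun _ : Fin k => gaussianReal 0 v) :=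
  Integrable.fintype_prod (f := fun m (x : ℝ) => x ^ n m) (fun m => gm_integrable v (n m))

lemma mono_integral (n : Fin k → ℕ) :
    ∫ e : Fin k → ℝ, ∏ m, e m ^ n m ∂(Measure.pi fun _ : Fin k => gaussianReal 0 v)
      = ∏ m, ∫ x, x ^ n m ∂(gaussianReal 0 v) :=
  integral_fintype_prod_eq_prod (fun m (x : ℝ) => x ^ n m)

lemma e_eq (e : Fin k → ℝ) (i : Fin k) : e i = ∏ m, e m ^ (if m = i then 1 else 0) := by
  simp

lemma two_eq (i j : Fin k) (e : Fin k → ℝ) : e i * e j =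
    ∏ m, e m ^ ((if m = i then 1 else 0) + (if m = j then 1 else 0)) := by
  simp only [pow_add, Finset.prod_mul_distrib, ← e_eq]
lemma three_eq (i j p : Fin k) (e : Fin k → ℝ) : e i * e j * e p =
    ∏ m, e m ^ ((if m = i then 1 else 0) + (if m = j then 1 else 0) + (if m = p then 1 else 0)) := by
  simp only [pow_add, Finset.prod_mul_distrib, ← e_eq]
lemma four_eq (i j p q : Fin k) (e : Fin k → ℝ) : e i * e j * e p * e q =
    ∏ m, e m ^ ((if m = i then 1 else 0) + (if m = j then 1 else 0) + (if m = p then 1 else 0)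
      + (if m = q then 1 else 0)) := by
  simp only [pow_add, Finset.prod_mul_distrib, ← e_eq]

lemma zero_of (n : Fin k → ℕ) (m : Fin k) (h : n m = 1 ∨ n m = 3) :
    ∏ m, ∫ x, x ^ n m ∂(gaussianReal 0 v) = 0 := by
  apply Finset.prod_eq_zero (Finset.mem_univ m)
  rcases h with h | h <;> rw [h]
  exacts [(gm_all v).1, (gm_all v).2.2.1]

lemma one_of (n : Fin k → ℕ) (i : Fin k) (h : ∀ m, m ≠ i → n m = 0) :
    ∏ m, ∫ x, x ^ n m ∂(gaussianReal 0 v) = ∫ x, x ^ n i ∂(gaussianReal 0 v) := by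
  apply Finset.prod_eq_single i
  · intro b _ hb; simp [h b hb]
  · simp

lemma pair_of (n : Fin k → ℕ) (i j : Fin k) (hij : i ≠ j) (hi : n i = 2) (hj : n j = 2)
    (h : ∀ m, m ≠ i → m ≠ j → n m = 0) :
    ∏ m, ∫ x, x ^ n m ∂(gaussianReal 0 v) = (v : ℝ) ^ 2 := by
  rw [Finset.prod_eq_mul i j hij (fun c _ hc => by simp [h c hc.1 hc.2]) (by simp) (by simp), hi, hj,
    (gm_all v).2.1]
  ring

lemma two_int (i j : Fin k) :
    ∫ e : Fin k → ℝ, e i * e j ∂(Measure.pi fun _ : Fin k => gaussianReal 0 v)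
      = if i = j then (v : ℝ) else 0 := by
  simp only [two_eq]
  rw [mono_integral]
  split_ifs with h
  · subst h
    rw [one_of v _ i (by intro m hm; simp [hm])]
    simpa using (gm_all v).2.1
  · exact zero_of v _ i (by simp [h])

lemma three_int (i j p : Fin k) :
    ∫ e : Fin k → ℝ, e i * e j * e p ∂(Measure.pi fun _ : Fin k => gaussianReal 0 v) = 0 := by
  simp only [three_eq]
  rw [mono_integral]
  by_cases h : i = j
  · exact zero_of v _ p (by split_ifs <;> simp_all)
  · by_cases h2 : i = p
    · exact zero_of v _ j (by split_ifs <;> simp_all)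
    · exact zero_of v _ i (by split_ifs <;> simp_all)

lemma four_int (i j p q : Fin k) :
    ∫ e : Fin k → ℝ, e i * e j * e p * e q ∂(Measure.pi fun _ : Fin k => gaussianReal 0 v)
      = (v : ℝ) ^ 2 * ((if i = j then if p = q then 1 else 0 else 0)
        + (if i = p then if j = q then 1 else 0 else 0)
        + (if i = q then if j = p then 1 else 0 else 0)) := by
  simp only [four_eq]
  rw [mono_integral]
  by_cases h1 : i = j
  · subst h1
    by_cases h2 : p = q
    · subst h2
      by_cases h3 : i = p
      · subst h3
        rw [one_of v _ i (by intro m hm; simp [hm])]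
        simp [(gm_all v).2.2.2]; ring
      · rw [pair_of v _ i p h3 (by simp [h3]) (by simp [Ne.symm h3]) (by intro m a b; simp [a, b])]
        simp [h3]
    · by_cases h3 : i = p
      · subst h3
        rw [zero_of v _ q (by simp [Ne.symm h2])]
        simp [h2]
      · rw [zero_of v _ p (by simp [Ne.symm h3, h2])]
        simp [h2, h3]
  · by_cases h2 : i = p
    · subst h2
      by_cases h3 : j = q
      · subst h3
        rw [pair_of v _ i j h1 (by simp [h1]) (by simp [Ne.symm h1]) (by intro m a b; simp [a, b])]
        simp [h1]
      · rw [zero_of v _ j (by simp [h3, Ne.symm h1])]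
        simp [h1, h3, Ne.symm h1]
    · by_cases h3 : i = q
      · subst h3
        by_cases h4 : j = p
        · subst h4
          rw [pair_of v _ i j h1 (by simp [h1]) (by simp [Ne.symm h1]) (by intro m a b; simp [a, b])]
          simp [h1]
        · rw [zero_of v _ j (by simp [h4, Ne.symm h1])]
          simp [h1, h2, h4]
      · rw [zero_of v _ i (by simp [h1, h2, h3])]
        simp [h1, h2, h3]

lemma two_able (i j : Fin k) : Integrable (fun e : Fin k → ℝ => e i * e j)
    (Measure.pi fun _ : Fin k => gaussianReal 0 v) := by
  simp only [two_eq]; exact mono_integrable v _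
lemma three_able (i j p : Fin k) : Integrable (fun e : Fin k → ℝ => e i * e j * e p)
    (Measure.pi fun _ : Fin k => gaussianReal 0 v) := by
  simp only [three_eq]; exact mono_integrable v _
lemma four_able (i j p q : Fin k) : Integrable (fun e : Fin k → ℝ => e i * e j * e p * e q)
    (Measure.pi fun _ : Fin k => gaussianReal 0 v) := by
  simp only [four_eq]; exact mono_integrable v _

lemma expand (g : Fin k → ℝ) (H : Matrix (Fin k) (Fin k) ℝ) (e : Fin k → ℝ) :
    (g ⬝ᵥ e + (1 / 2) * (e ⬝ᵥ H.mulVec e)) ^ 2 =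
      (∑ i, ∑ j, g i * g j * (e i * e j)) + (∑ i, ∑ j, ∑ p, g i * H j p * (e i * e j * e p))
      + ∑ i, ∑ j, ∑ p, ∑ q, (H i j * H p q / 4) * (e i * e j * e p * e q) := by
  have h1 : (∑ i, ∑ j, g i * g j * (e i * e j)) = (g ⬝ᵥ e) * (g ⬝ᵥ e) := by
    simp only [dotProduct, Finset.sum_mul_sum]
    refine Finset.sum_congr rfl fun i _ => Finset.sum_congr rfl fun j _ => by ring
  have hQ : e ⬝ᵥ H.mulVec e = ∑ i, ∑ j, H i j * (e i * e j) := by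
    simp only [dotProduct, mulVec, Finset.mul_sum]
    refine Finset.sum_congr rfl fun i _ => Finset.sum_congr rfl fun j _ => by ring
  have h2 : (∑ i, ∑ j, ∑ p, g i * H j p * (e i * e j * e p)) = (g ⬝ᵥ e) * (e ⬝ᵥ H.mulVec e) := by
    rw [hQ]
    rw [dotProduct, Finset.sum_mul]
    simp only [Finset.mul_sum]
    refine Finset.sum_congr rfl fun i _ => Finset.sum_congr rfl fun j _ =>
      Finset.sum_congr rfl fun p _ => by ring
  have h3 : (∑ i, ∑ j, ∑ p, ∑ q, (H i j * H p q / 4) * (e i * e j * e p * e q)) =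
      (e ⬝ᵥ H.mulVec e) * (e ⬝ᵥ H.mulVec e) / 4 := by
    rw [hQ]
    simp only [Finset.sum_mul, Finset.mul_sum, Finset.sum_div]
    refine Finset.sum_congr rfl fun i _ => Finset.sum_congr rfl fun j _ =>
      Finset.sum_congr rfl fun p _ => Finset.sum_congr rfl fun q _ => by ring
  rw [h1, h2, h3]; ring

lemma main_int (g : Fin k → ℝ) (H : Matrix (Fin k) (Fin k) ℝ) (hH : ∀ i j, H i j = H j i) :
    ∫ e : Fin k → ℝ, (g ⬝ᵥ e + (1 / 2) * (e ⬝ᵥ H.mulVec e)) ^ 2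
      ∂(Measure.pi fun _ : Fin k => gaussianReal 0 v) =
    (v : ℝ) * (∑ i, (g i) ^ 2)
          + ((v : ℝ) ^ 2 / 4) * (2 * (∑ i, ∑ j, (H i j) ^ 2) + (H.trace) ^ 2) := by
  simp only [expand]
  have i2 := fun i j => (two_able v i j).const_mul (g i * g j)
  have i3 := fun i j p => (three_able v i j p).const_mul (g i * H j p)
  have i4 := fun i j p q => (four_able v i j p q).const_mul (H i j * H p q / 4)
  have j2 := fun i => integrable_finsetSum Finset.univ fun j _ => i2 i j
  have j3 := fun i j => integrable_finsetSum Finset.univ fun p _ => i3 i j p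
  have k3 := fun i => integrable_finsetSum Finset.univ fun j _ => j3 i j
  have j4 := fun i j p => integrable_finsetSum Finset.univ fun q _ => i4 i j p q
  have k4 := fun i j => integrable_finsetSum Finset.univ fun p _ => j4 i j p
  have l4 := fun i => integrable_finsetSum Finset.univ fun j _ => k4 i j
  have m2 := integrable_finsetSum Finset.univ fun i _ => j2 i
  have m3 := integrable_finsetSum Finset.univ fun i _ => k3 i
  have m4 := integrable_finsetSum Finset.univ fun i _ => l4 i
  rw [integral_add (m2.fun_add m3) m4, integral_add m2 m3]
  rw [integral_finsetSum _ fun i _ => j2 i, integral_finsetSum _ fun i _ => k3 i,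
    integral_finsetSum _ fun i _ => l4 i]
  simp only [fun i => integral_finsetSum Finset.univ fun j _ => i2 i j,
    fun i => integral_finsetSum Finset.univ fun j _ => j3 i j,
    fun i j => integral_finsetSum Finset.univ fun p _ => i3 i j p,
    fun i => integral_finsetSum Finset.univ fun j _ => k4 i j,
    fun i j => integral_finsetSum Finset.univ fun p _ => j4 i j p,
    fun i j p => integral_finsetSum Finset.univ fun q _ => i4 i j p q,
    integral_const_mul, two_int, three_int, four_int]
  simp only [mul_add, Finset.sum_add_distrib, mul_ite, mul_one, mul_zero, Finset.sum_ite_eq,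
    Finset.mem_univ, if_true, Finset.sum_const_zero, add_zero, Finset.sum_ite_irrel]
  have t : H.trace ^ 2 = ∑ i, ∑ p, H i i * H p p := by
    simp [Matrix.trace, sq, Finset.sum_mul_sum]
  rw [t]
  simp only [Finset.mul_sum, ← Finset.sum_add_distrib]
  refine Finset.sum_congr rfl fun i _ => congrArg₂ _ (by ring) (Finset.sum_congr rfl fun j _ => ?_)
  rw [hH j i]
  ring
end

lemma eig_sq {k : ℕ} (H : Matrix (Fin k) (Fin k) ℝ) (hH : H.IsHermitian) :
    ∑ i, (hH.eigenvalues i) ^ 2 = ∑ i, ∑ j, (H i j) ^ 2 := by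
  have h1 : (H * H).trace = ∑ i, ∑ j, (H i j) ^ 2 := by
    simp only [Matrix.trace, Matrix.diag, Matrix.mul_apply]
    refine Finset.sum_congr rfl fun i _ => Finset.sum_congr rfl fun j _ => ?_
    have := hH.apply i j
    simp at this
    rw [this]; ring
  rw [← h1]
  have h2 := hH.spectral_theorem
  have h3 : H * H = Unitary.conjStarAlgAut ℝ _ hH.eigenvectorUnitary
      (diagonal (fun i => hH.eigenvalues i ^ 2)) := by
    conv_lhs => rw [h2]
    rw [← map_mul, diagonal_mul_diagonal]
    congr 2
    ext i; simp [sq]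
  rw [h3, Unitary.conjStarAlgAut_apply, Matrix.trace_mul_comm, ← mul_assoc]
  simp [Matrix.trace]

/-- If the exact second-order expansion `l(x+ε) = l(x) + gᵀε + ½ εᵀHε` holds with `H`
symmetric and `ε ∼ N(0, σ² I_k)`, then
`E[(l(x+ε) − l(x))²] = σ²‖g‖² + (σ⁴/4)(2‖H‖_F² + (tr H)²)`, and in particular
`E[(l(x+ε) − l(x))²] ≥ (σ⁴/2) Σ_i λ_i²` where `λ_i` are the eigenvalues of `H`. -/
theorem expected_sq_loss_change_eq_and_curvature_lower_bound
    {k : ℕ} (σ : ℝ≥0) (l : (Fin k → ℝ) → ℝ) (hl : ContDiff ℝ 2 l)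
    (x : Fin k → ℝ) (g : Fin k → ℝ) (H : Matrix (Fin k) (Fin k) ℝ)
    (hH : H.IsHermitian)
    (hexp : ∀ ε : Fin k → ℝ,
      l (x + ε) = l x + g ⬝ᵥ ε + (1 / 2) * (ε ⬝ᵥ H.mulVec ε)) :
    (∫ ε : Fin k → ℝ, (l (x + ε) - l x) ^ 2
          ∂(Measure.pi fun _ : Fin k => gaussianReal 0 (σ ^ 2))
        = (σ : ℝ) ^ 2 * (∑ i, (g i) ^ 2)
          + ((σ : ℝ) ^ 4 / 4) * (2 * (∑ i, ∑ j, (H i j) ^ 2) + (H.trace) ^ 2))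
    ∧ ((σ : ℝ) ^ 4 / 2) * (∑ i, (hH.eigenvalues i) ^ 2)
        ≤ ∫ ε : Fin k → ℝ, (l (x + ε) - l x) ^ 2
            ∂(Measure.pi fun _ : Fin k => gaussianReal 0 (σ ^ 2)) := by
  have key : ∫ ε : Fin k → ℝ, (l (x + ε) - l x) ^ 2
          ∂(Measure.pi fun _ : Fin k => gaussianReal 0 (σ ^ 2))
        = (σ : ℝ) ^ 2 * (∑ i, (g i) ^ 2)
          + ((σ : ℝ) ^ 4 / 4) * (2 * (∑ i, ∑ j, (H i j) ^ 2) + (H.trace) ^ 2) := by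
    have h1 : ∀ ε : Fin k → ℝ, l (x + ε) - l x = g ⬝ᵥ ε + (1 / 2) * (ε ⬝ᵥ H.mulVec ε) := by
      intro ε; rw [hexp]; ring
    simp only [h1]
    rw [main_int (σ ^ 2) g H (fun i j => by simpa using hH.apply j i)]
    push_cast
    ring
  refine ⟨key, ?_⟩
  rw [key, eig_sq H hH]
  have h1 : 0 ≤ (σ : ℝ) ^ 2 * (∑ i, (g i) ^ 2) := by positivity
  have h2 : 0 ≤ (σ : ℝ) ^ 4 / 4 * H.trace ^ 2 := by positivity
  linarith
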